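/- The function Y is strictly monotone increasing on the open interval (0,1); that is, for all s, t with 0 < s < t < 1 we have Y(s) < Y(t). -/

import Mathlib

noncomputable def h1 (t : ℝ) : ℝ := (2*t+1)/((3*t+1)*(1-t))

noncomputable def h2 (t : ℝ) : ℝ :=
  -(t^2*(1-t)*(5*t^2+36*t+18))/(2*(t+3)*(2*t+1)*(3*t+1)^2)

noncomputable def Y (t : ℝ) : ℝ := -1 + h1 t * Real.exp (h2 t)

lemma h1_hasDeriv (t : ℝ) (h0 : 0 < t) (ht : t < 1) :
    HasDerivAt h1 (6*t*(1+t)/((3*t+1)*(1-t))^2) t := by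
  have e1 : (1 - t) ≠ 0 := by linarith
  have e2 : (3*t+1) ≠ 0 := by positivity
  have a := hasDerivAt_id t
  have n := (a.const_mul 2).add_const 1
  have d := ((a.const_mul 3).add_const 1).mul (a.const_sub 1)
  have q := n.div d (by simpa using ⟨e2, e1⟩)
  refine HasDerivAt.congr_deriv (f := h1) q ?_
  simp only [id, Pi.mul_apply]
  congr 1
  ring

lemma h2_hasDeriv (t : ℝ) (h0 : 0 < t) :
    HasDerivAt h2 (-((36*t+54*t^2-124*t^3-25*t^4)*((t+3)*(2*t+1)*(3*t+1))
      - t^2*(1-t)*(5*t^2+36*t+18)*((2*t+1)*(3*t+1)+2*(t+3)*(3*t+1)+6*(t+3)*(2*t+1)))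
      /(2*(t+3)^2*(2*t+1)^2*(3*t+1)^3)) t := by
  have a := hasDerivAt_id t
  have n := (((a.pow 2).mul (a.const_sub 1)).mul
    ((((a.pow 2).const_mul 5).add (a.const_mul 36)).add_const 18)).neg
  have d := (((a.add_const 3).const_mul 2).mul ((a.const_mul 2).add_const 1)).mul
    (((a.const_mul 3).add_const 1).pow 2)
  have q := n.div d (by
    simp only [id, Pi.mul_apply, Pi.pow_apply]
    positivity)
  refine HasDerivAt.congr_deriv (f := h2) q ?_
  simp only [id, Pi.mul_apply, Pi.pow_apply, Pi.neg_apply, Pi.add_apply]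
  have e1 : (t+3) ≠ 0 := by positivity
  have e2 : (3*t+1) ≠ 0 := by positivity
  have e3 : (2*t+1) ≠ 0 := by positivity
  rw [div_eq_div_iff (by positivity) (by positivity)]
  push_cast
  ring

lemma Y_hasDeriv (t : ℝ) (h0 : 0 < t) (ht : t < 1) :
    HasDerivAt Y (Real.exp (h2 t) *
      ((864*t^2+4416*t^3+7536*t^4+4794*t^5+846*t^6+6*t^7-30*t^8) /
        (2*(t+3)^2*(2*t+1)*(3*t+1)^4*(1-t)^2))) t := by
  have q := ((h1_hasDeriv t h0 ht).mul (h2_hasDeriv t h0).exp).const_add (-1)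
  refine HasDerivAt.congr_deriv (f := Y) q ?_
  have e0 : (1 - t) ≠ 0 := by linarith
  have e1 : (t+3) ≠ 0 := by positivity
  have e2 : (3*t+1) ≠ 0 := by positivity
  have e3 : (2*t+1) ≠ 0 := by positivity
  have : ∀ E a b c d : ℝ, a + b * c = d → a * E + b * (E * c) = E * d := by
    intro E a b c d h
    rw [← h]; ring
  apply this
  unfold h1
  field_simp
  ring

theorem Y_strictMono : ∀ s t : ℝ, 0 < s → s < t → t < 1 → Y s < Y t := by
  intro s t hs hst ht
  have hm : StrictMonoOn Y (Set.Ioo 0 1) := by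
    apply strictMonoOn_of_deriv_pos (convex_Ioo 0 1)
    · intro x hx
      exact (Y_hasDeriv x hx.1 hx.2).continuousAt.continuousWithinAt
    · intro x hx
      rw [interior_Ioo] at hx
      obtain ⟨h0, h1⟩ := hx
      rw [(Y_hasDeriv x h0 h1).deriv]
      have e0 : 0 < 1 - x := by linarith
      have h8 : x^8 ≤ x^2 := pow_le_pow_of_le_one h0.le h1.le (by norm_num)
      have hp : 0 < 864*x^2+4416*x^3+7536*x^4+4794*x^5+846*x^6+6*x^7-30*x^8 := by
        have : 0 < 834*x^2+4416*x^3+7536*x^4+4794*x^5+846*x^6+6*x^7 := by positivity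
        linarith
      positivity
  exact hm ⟨hs, hst.trans ht⟩ ⟨hs.trans hst, ht⟩ hst
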